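/- arXiv:1812.02389 — 2 statements merged into one kernel-verified Lean document; each statement's English description precedes it below -/
import Mathlib

section
/- Let p > 2 and N ≥ 1. There exist constants γ > 0 and Γ > 0, depending only on p, such that for every ε ∈ ℝ, every z ∈ ℝ^N and every ζ ∈ ℝ^N, γ (κ + ‖z‖)^{p−2} ‖ζ‖² ≤ ⟨M_ε(z) ζ, ζ⟩ ≤ Γ (κ + ‖z‖)^{p−2} ‖ζ‖², where κ = |ε|^{2/(p−2)}. -/
open Classical
open scoped InnerProductSpace

/-- The matrix `M_ε(z)`: the Fréchet derivative of `A_ε(z) = (ε² + ‖z‖^(p-2)) z`,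
namely `(ε² + ‖z‖^(p-2)) I + (p-2)‖z‖^(p-4) z zᵀ` for `z ≠ 0` and `ε² I` at `z = 0`. -/
noncomputable def Mmat (N : ℕ) (p ε : ℝ) (z : EuclideanSpace ℝ (Fin N)) :
    Matrix (Fin N) (Fin N) ℝ :=
  if z = 0 then ε ^ 2 • (1 : Matrix (Fin N) (Fin N) ℝ)
  else Matrix.of fun i j =>
    (ε ^ 2 + ‖z‖ ^ (p - 2)) * (if i = j then (1 : ℝ) else 0)
      + (p - 2) * ‖z‖ ^ (p - 4) * z i * z j

theorem inner_toEuclideanLin_Mmat {N : ℕ} {p : ℝ} (hp : 2 < p) (ε : ℝ)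
    (z ζ : EuclideanSpace ℝ (Fin N)) :
    ⟪Matrix.toEuclideanLin (Mmat N p ε z) ζ, ζ⟫_ℝ =
      (ε ^ 2 + ‖z‖ ^ (p - 2)) * ‖ζ‖ ^ 2 + (p - 2) * ‖z‖ ^ (p - 4) * ⟪z, ζ⟫_ℝ ^ 2 := by
  have hM : Mmat N p ε z = (ε ^ 2 + ‖z‖ ^ (p - 2)) • (1 : Matrix (Fin N) (Fin N) ℝ)
      + ((p - 2) * ‖z‖ ^ (p - 4)) • Matrix.vecMulVec z z := by
    unfold Mmat
    split_ifs with h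
    · subst h
      ext i j
      simp [Real.zero_rpow (sub_pos.2 hp).ne']
    · ext i j
      simp only [Matrix.of_apply, Matrix.add_apply, Matrix.smul_apply, Matrix.one_apply,
        Matrix.vecMulVec_apply, smul_eq_mul]
      ring_nf
  have hv : Matrix.toEuclideanLin (Matrix.vecMulVec z z) ζ = ⟪z, ζ⟫_ℝ • z := by
    ext i
    simp only [Matrix.toLpLin_apply, Matrix.vecMulVec_mulVec, PiLp.smul_apply, smul_eq_mul,
      PiLp.inner_apply, dotProduct]
    simp [mul_comm]
  have h1 : Matrix.toEuclideanLin (1 : Matrix (Fin N) (Fin N) ℝ) ζ = ζ := by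
    ext i
    simp
  rw [hM, map_add, map_smul, map_smul, LinearMap.add_apply, LinearMap.smul_apply,
    LinearMap.smul_apply, hv, h1, inner_add_left, real_inner_smul_left, real_inner_smul_left,
    real_inner_smul_left, real_inner_self_eq_norm_sq]
  ring

theorem Real.add_rpow_le_two_rpow_mul_add {a b s : ℝ} (ha : 0 ≤ a) (hb : 0 ≤ b) (hs : 0 ≤ s) :
    (a + b) ^ s ≤ 2 ^ s * (a ^ s + b ^ s) := by
  have hm : max a b ^ s ≤ a ^ s + b ^ s := by
    have := Real.rpow_nonneg ha s
    have := Real.rpow_nonneg hb s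
    rcases max_choice a b with h | h <;> rw [h] <;> linarith
  calc (a + b) ^ s ≤ (2 * max a b) ^ s := by
        gcongr
        linarith [le_max_left a b, le_max_right a b]
    _ = 2 ^ s * max a b ^ s := Real.mul_rpow zero_le_two (le_max_of_le_left ha)
    _ ≤ 2 ^ s * (a ^ s + b ^ s) := by gcongr

/-- for `p > 2` there are constants `γ, Γ > 0` depending only on `p` such
that for every `N ≥ 1`, `ε ∈ ℝ`, `z, ζ ∈ ℝ^N`, with `κ = |ε|^(2/(p-2))`,
`γ (κ + ‖z‖)^(p−2) ‖ζ‖² ≤ ⟨M_ε(z) ζ, ζ⟩ ≤ Γ (κ + ‖z‖)^(p−2) ‖ζ‖²`. -/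
theorem stmt5 (p : ℝ) (hp : 2 < p) :
    ∃ γ > (0 : ℝ), ∃ Γ > (0 : ℝ), ∀ N : ℕ, 1 ≤ N → ∀ ε : ℝ,
      ∀ z ζ : EuclideanSpace ℝ (Fin N),
        γ * (|ε| ^ (2 / (p - 2)) + ‖z‖) ^ (p - 2) * ‖ζ‖ ^ 2
            ≤ ⟪Matrix.toEuclideanLin (Mmat N p ε z) ζ, ζ⟫_ℝ ∧
          ⟪Matrix.toEuclideanLin (Mmat N p ε z) ζ, ζ⟫_ℝ
            ≤ Γ * (|ε| ^ (2 / (p - 2)) + ‖z‖) ^ (p - 2) * ‖ζ‖ ^ 2 := by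
  have hs : 0 < p - 2 := sub_pos.2 hp
  refine ⟨(2 ^ (p - 2))⁻¹, by positivity, p, by linarith, fun N _ ε z ζ => ?_⟩
  rw [inner_toEuclideanLin_Mmat hp]
  set κ := |ε| ^ (2 / (p - 2)) with hκ
  have hκ0 : 0 ≤ κ := by positivity
  have hκs : κ ^ (p - 2) = ε ^ 2 := by
    rw [hκ, ← Real.rpow_mul (abs_nonneg ε), div_mul_cancel₀ _ hs.ne', Real.rpow_two, sq_abs]
  rw [← hκs]
  have hcs : ‖z‖ ^ (p - 4) * ⟪z, ζ⟫_ℝ ^ 2 ≤ ‖z‖ ^ (p - 2) * ‖ζ‖ ^ 2 := by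
    rcases eq_or_ne z 0 with rfl | hz
    · simp [Real.zero_rpow hs.ne']
    · have hr : ‖z‖ ^ (p - 2) = ‖z‖ ^ (p - 4) * ‖z‖ ^ 2 := by
        rw [← Real.rpow_two, ← Real.rpow_add (norm_pos_iff.2 hz)]
        ring_nf
      rw [hr, mul_assoc, ← mul_pow, ← sq_abs]
      gcongr
      exact abs_real_inner_le_norm z ζ
  constructor
  · have h : (2 ^ (p - 2))⁻¹ * (κ + ‖z‖) ^ (p - 2) ≤ κ ^ (p - 2) + ‖z‖ ^ (p - 2) := by
      rw [inv_mul_le_iff₀ (by positivity)]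
      exact Real.add_rpow_le_two_rpow_mul_add hκ0 (norm_nonneg z) hs.le
    refine (mul_le_mul_of_nonneg_right h (sq_nonneg ‖ζ‖)).trans (le_add_of_nonneg_right ?_)
    positivity
  · have hκle : κ ^ (p - 2) ≤ (κ + ‖z‖) ^ (p - 2) :=
      Real.rpow_le_rpow hκ0 (le_add_of_nonneg_right (norm_nonneg z)) hs.le
    have hzle : ‖z‖ ^ (p - 2) ≤ (κ + ‖z‖) ^ (p - 2) :=
      Real.rpow_le_rpow (norm_nonneg z) (le_add_of_nonneg_left hκ0) hs.le
    calc (κ ^ (p - 2) + ‖z‖ ^ (p - 2)) * ‖ζ‖ ^ 2 + (p - 2) * ‖z‖ ^ (p - 4) * ⟪z, ζ⟫_ℝ ^ 2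
        ≤ (κ ^ (p - 2) + ‖z‖ ^ (p - 2)) * ‖ζ‖ ^ 2
            + (p - 2) * (‖z‖ ^ (p - 2) * ‖ζ‖ ^ 2) := by
          rw [mul_assoc (p - 2)]
          gcongr
      _ = (κ ^ (p - 2) + ‖z‖ ^ (p - 2) + (p - 2) * ‖z‖ ^ (p - 2)) * ‖ζ‖ ^ 2 := by ring
      _ ≤ ((κ + ‖z‖) ^ (p - 2) + (κ + ‖z‖) ^ (p - 2)
            + (p - 2) * (κ + ‖z‖) ^ (p - 2)) * ‖ζ‖ ^ 2 := by gcongr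
      _ = p * (κ + ‖z‖) ^ (p - 2) * ‖ζ‖ ^ 2 := by ring
end

section
/- Let 2 < p < m be real numbers, let f : ℝ → ℝ be continuous, and define F(t) = ∫₀ᵗ f(s) ds. Suppose there exists T > 0 such that for every t ∈ ℝ with |t| ≥ T one has f(t)·t ≥ m F(t) > 0. Then there exist constants a > 0 and b > 0 such that F(t) ≥ a |t|^m − b for every t ∈ ℝ. -/
/-- A function `G` with `m * G t ≤ t * deriv G t` on `[T, ∞)` dominates the multiple of `t ^ m` that
agrees with it at `T`. -/
theorem div_rpow_mul_rpow_le_of_mul_le_deriv_mul {G g : ℝ → ℝ} {m T : ℝ} (hT : 0 < T)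
    (hG : ∀ t, T ≤ t → HasDerivAt G (g t) t) (hg : ∀ t, T ≤ t → m * G t ≤ g t * t)
    {t : ℝ} (ht : T ≤ t) : G T / T ^ m * t ^ m ≤ G t := by
  have hderiv : ∀ x, T ≤ x → HasDerivAt (fun x => G x * x ^ (-m))
      (g x * x ^ (-m) + G x * (-m * x ^ (-m - 1))) x := fun x hx =>
    (hG x hx).mul (Real.hasDerivAt_rpow_const (Or.inl (hT.trans_le hx).ne'))
  have hmono : MonotoneOn (fun x => G x * x ^ (-m)) (Set.Ici T) := by
    refine monotoneOn_of_deriv_nonneg (convex_Ici T)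
      (fun x hx => (hderiv x hx).continuousAt.continuousWithinAt)
      (fun x hx => (hderiv x (interior_subset hx)).differentiableAt.differentiableWithinAt)
      fun x hx => ?_
    have hTx : T ≤ x := interior_subset hx
    have hx0 : 0 < x := hT.trans_le hTx
    have hpow : x ^ (-m) = x ^ (-m - 1) * x := by
      rw [← Real.rpow_add_one hx0.ne', sub_add_cancel]
    rw [(hderiv x hTx).deriv, hpow]
    have := mul_nonneg (Real.rpow_pos_of_pos hx0 (-m - 1)).le (sub_nonneg.2 (hg x hTx))
    linarith
  have h : G T * T ^ (-m) ≤ G t * t ^ (-m) := hmono Set.self_mem_Ici ht ht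
  have ht0 : 0 < t := hT.trans_le ht
  rw [Real.rpow_neg hT.le, Real.rpow_neg ht0.le, ← div_eq_mul_inv, ← div_eq_mul_inv] at h
  exact (le_div_iff₀ (Real.rpow_pos_of_pos ht0 m)).1 h

/-- if `2 < p < m`, `f` is continuous, `F(t) = ∫₀ᵗ f`, and there is `T > 0`
with `f(t) t ≥ m F(t) > 0` whenever `|t| ≥ T`, then there are `a, b > 0` with
`F(t) ≥ a |t|^m − b` for all `t`. -/
theorem stmt9 (p m : ℝ) (hp : 2 < p) (hpm : p < m)
    (f : ℝ → ℝ) (hf : Continuous f)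
    (F : ℝ → ℝ) (hF : ∀ t : ℝ, F t = ∫ s in (0 : ℝ)..t, f s)
    (T : ℝ) (hT : 0 < T)
    (hgrow : ∀ t : ℝ, T ≤ |t| → m * F t ≤ f t * t ∧ 0 < m * F t) :
    ∃ a > (0 : ℝ), ∃ b > (0 : ℝ), ∀ t : ℝ, a * |t| ^ m - b ≤ F t := by
  have hm : 0 < m := by linarith
  have hderiv : ∀ t, HasDerivAt F (f t) t := fun t => by
    rw [funext hF]
    exact hf.integral_hasStrictDerivAt 0 t |>.hasDerivAt
  have hderiv_neg : ∀ t, HasDerivAt (fun t => F (-t)) (-f (-t)) t := fun t => by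
    simpa [Function.comp_def] using (hderiv (-t)).comp t (hasDerivAt_neg t)
  have habs : ∀ t, T ≤ t → T ≤ |t| := fun t ht => ht.trans (le_abs_self t)
  have hpos : ∀ t, T ≤ |t| → 0 < F t := fun t ht => (mul_pos_iff_of_pos_left hm).1 (hgrow t ht).2
  have hright : ∀ t, T ≤ t → F T / T ^ m * t ^ m ≤ F t := fun t ht =>
    div_rpow_mul_rpow_le_of_mul_le_deriv_mul hT (fun s _ => hderiv s)
      (fun s hs => (hgrow s (habs s hs)).1) ht
  have hleft : ∀ t, T ≤ t → F (-T) / T ^ m * t ^ m ≤ F (-t) := fun t ht =>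
    div_rpow_mul_rpow_le_of_mul_le_deriv_mul (G := fun t => F (-t)) hT (fun s _ => hderiv_neg s)
      (fun s hs => by simpa using (hgrow (-s) (by simpa using habs s hs)).1) ht
  have hFcont : Continuous F := continuous_iff_continuousAt.2 fun t => (hderiv t).continuousAt
  obtain ⟨B, hB⟩ := (isCompact_Icc (a := -T) (b := T)).exists_bound_of_continuousOn
    hFcont.continuousOn
  have hTm : 0 < T ^ m := Real.rpow_pos_of_pos hT m
  have hFT : 0 < F T := hpos T (habs T le_rfl)
  have hFnT : 0 < F (-T) := hpos (-T) (by simpa using habs T le_rfl)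
  have hB0 : 0 ≤ B := (norm_nonneg _).trans (hB T ⟨by linarith, le_rfl⟩)
  set a := min (F T / T ^ m) (F (-T) / T ^ m)
  have ha : 0 < a := lt_min (div_pos hFT hTm) (div_pos hFnT hTm)
  have hb : 0 < a * T ^ m + B := by positivity
  refine ⟨a, ha, a * T ^ m + B, hb, fun t => ?_⟩
  have htm : 0 ≤ |t| ^ m := Real.rpow_nonneg (abs_nonneg t) m
  rcases le_total |t| T with ht | ht
  · have h₁ : a * |t| ^ m ≤ a * T ^ m := by gcongr
    have h₂ := (abs_le.1 (hB t (abs_le.1 ht))).1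
    linarith
  · rcases abs_choice t with h | h
    · have h₁ := hright |t| ht
      have h₂ := mul_le_mul_of_nonneg_right (min_le_left (F T / T ^ m) (F (-T) / T ^ m)) htm
      rw [h] at h₁ h₂ ⊢
      linarith
    · have h₁ := hleft |t| ht
      have h₂ := mul_le_mul_of_nonneg_right (min_le_right (F T / T ^ m) (F (-T) / T ^ m)) htm
      rw [h] at h₁ h₂ ⊢
      rw [neg_neg] at h₁
      linarith
end
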